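/- Every almost 3-α-Sasakian manifold is necessarily 3-α-Sasakian; that is, if an almost 3-contact metric manifold satisfies dη_δ = α Φ_δ for each δ ∈ {1,2,3} and some α ∈ ℝ\{0}, then each of the three almost contact metric structures is automatically normal. -/

import Mathlib

/-!
An abstract (Lie–Rinehart style) algebraic model of the differential geometry of
almost contact metric 3-structures: `F` plays the role of the algebra of smooth
functions on a manifold `M` of dimension `4n+3`, and `V` plays the role of the
`F`-module of smooth vector fields, acting on `F` by derivations and carrying a
Lie bracket, a Riemannian metric `g`, and three almost contact metric structures
`(φ_α, ξ_α, η_α, g)`.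
-/

noncomputable section

namespace QS3

/-- Cyclic (= even) permutations of `{0,1,2}`, modelling even permutations of `{1,2,3}`. -/
def Cyclic (a b c : Fin 3) : Prop :=
  (a, b, c) = (0, 1, 2) ∨ (a, b, c) = (1, 2, 0) ∨ (a, b, c) = (2, 0, 1)

/-- The algebraic model of the smooth structure of a manifold: an `ℝ`-algebra `F`
of smooth functions and an `F`-module `V` of vector fields acting on `F` by
derivations and carrying the Lie bracket of vector fields. -/
class SmoothSetting (F : Type) (V : Type) [CommRing F] [Algebra ℝ F]
    [AddCommGroup V] [Module F V] where
  act : V → F → F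
  bracket : V → V → V
  act_add : ∀ (X : V) (f₁ f₂ : F), act X (f₁ + f₂) = act X f₁ + act X f₂
  act_mul : ∀ (X : V) (f₁ f₂ : F), act X (f₁ * f₂) = act X f₁ * f₂ + f₁ * act X f₂
  act_const : ∀ (X : V) (r : ℝ), act X (algebraMap ℝ F r) = 0
  act_addLeft : ∀ (X Y : V) (f : F), act (X + Y) f = act X f + act Y f
  act_smulLeft : ∀ (f : F) (X : V) (h : F), act (f • X) h = f * act X h
  bracket_antisymm : ∀ X Y : V, bracket X Y = -bracket Y X
  bracket_addLeft : ∀ X Y Z : V, bracket (X + Y) Z = bracket X Z + bracket Y Z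
  bracket_act : ∀ (X Y : V) (f : F),
    act (bracket X Y) f = act X (act Y f) - act Y (act X f)
  bracket_smulRight : ∀ (X : V) (f : F) (Y : V),
    bracket X (f • Y) = f • bracket X Y + act X f • Y
  jacobi : ∀ X Y Z : V,
    bracket X (bracket Y Z) + bracket Y (bracket Z X) + bracket Z (bracket X Y) = 0

section d

variable (F V : Type) [CommRing F] [Algebra ℝ F] [AddCommGroup V] [Module F V]
  [SmoothSetting F V]

/-- The action of a vector field on a function (directional derivative). -/
def der (X : V) (f : F) : F := SmoothSetting.act X f

/-- The Lie bracket of vector fields. -/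
def lie (X Y : V) : V := SmoothSetting.bracket F X Y

/-- Exterior differential of a 1-form (with the `1/2` normalization convention,
so that `2 dθ(X,Y) = X θ(Y) - Y θ(X) - θ([X,Y])`). -/
def dOne (θ : V → F) (X Y : V) : F :=
  (2 : ℝ)⁻¹ • (der F V X (θ Y) - der F V Y (θ X) - θ (lie F V X Y))

/-- Exterior differential of a 2-form (with the `1/3` normalization convention). -/
def dTwo (ω : V → V → F) (X Y Z : V) : F :=
  (3 : ℝ)⁻¹ • (der F V X (ω Y Z) + der F V Y (ω Z X) + der F V Z (ω X Y)
    - ω (lie F V X Y) Z - ω (lie F V Y Z) X - ω (lie F V Z X) Y)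

end d

/-- An almost contact metric 3-structure on a manifold of dimension `4n+3`:
three almost contact metric structures `(φ_α, ξ_α, η_α, g)` satisfying the
quaternionic-type relations, together with a (local) orthonormal frame. -/
class ACM3 (F V : Type) [CommRing F] [Algebra ℝ F] [AddCommGroup V] [Module F V]
    [SmoothSetting F V] where
  n : ℕ
  g : V → V → F
  phi : Fin 3 → V → V
  xi : Fin 3 → V
  eta : Fin 3 → V → F
  g_symm : ∀ X Y, g X Y = g Y X
  g_addLeft : ∀ X Y Z, g (X + Y) Z = g X Z + g Y Z
  g_smulLeft : ∀ (f : F) (X Y : V), g (f • X) Y = f * g X Y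
  g_nondeg : ∀ X, (∀ Y, g X Y = 0) → X = 0
  phi_add : ∀ α (X Y : V), phi α (X + Y) = phi α X + phi α Y
  phi_smul : ∀ α (f : F) (X : V), phi α (f • X) = f • phi α X
  eta_eq : ∀ α X, eta α X = g X (xi α)
  acm_sq : ∀ α X, phi α (phi α X) = -X + eta α X • xi α
  eta_xi : ∀ α, eta α (xi α) = 1
  compat : ∀ α X Y, g (phi α X) (phi α Y) = g X Y - eta α X * eta α Y
  quat_phi : ∀ a b c, Cyclic a b c → ∀ X, phi c X = phi a (phi b X) - eta b X • xi a
  quat_phi' : ∀ a b c, Cyclic a b c → ∀ X, phi c X = -(phi b (phi a X)) + eta a X • xi b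
  quat_xi : ∀ a b c, Cyclic a b c → xi c = phi a (xi b)
  quat_xi' : ∀ a b c, Cyclic a b c → xi c = -(phi b (xi a))
  quat_eta : ∀ a b c, Cyclic a b c → ∀ X, eta c X = eta a (phi b X)
  quat_eta' : ∀ a b c, Cyclic a b c → ∀ X, eta c X = -(eta b (phi a X))
  frame : Fin (4 * n + 3) → V
  frame_orth : ∀ i j, g (frame i) (frame j) = if i = j then 1 else 0
  frame_span : ∀ X : V, X = ∑ i, g X (frame i) • frame i

section acm

variable (F V : Type) [CommRing F] [Algebra ℝ F] [AddCommGroup V] [Module F V]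
  [SmoothSetting F V] [ACM3 F V]

/-- The integer `n` (the manifold has dimension `4n+3`). -/
def dimn : ℕ := ACM3.n F V

/-- The Riemannian metric. -/
def gm (X Y : V) : F := ACM3.g X Y

/-- The structure tensors `φ_α`. -/
def ph (α : Fin 3) (X : V) : V := ACM3.phi F α X

/-- The Reeb vector fields `ξ_α`. -/
def rxi (α : Fin 3) : V := ACM3.xi F α

/-- The 1-forms `η_α`. -/
def et (α : Fin 3) (X : V) : F := ACM3.eta α X

/-- The orthonormal frame. -/
def fr (i : Fin (4 * dimn F V + 3)) : V := ACM3.frame i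

/-- The fundamental 2-form `Φ_α(X,Y) = g(X, φ_α Y)`. -/
def Phi (α : Fin 3) (X Y : V) : F := gm F V X (ph F V α Y)

/-- The Nijenhuis torsion `[φ_α, φ_α]` of `φ_α`. -/
def Nij (α : Fin 3) (X Y : V) : V :=
  ph F V α (ph F V α (lie F V X Y)) + lie F V (ph F V α X) (ph F V α Y)
    - ph F V α (lie F V (ph F V α X) Y) - ph F V α (lie F V X (ph F V α Y))

/-- The normality tensor `N⁽¹⁾_α = [φ_α, φ_α] + 2 dη_α ⊗ ξ_α`. -/
def NOne (α : Fin 3) (X Y : V) : V :=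
  Nij F V α X Y + ((2 : ℝ) • dOne F V (et F V α) X Y) • rxi F V α

/-- The structure `(φ_α, ξ_α, η_α)` is normal. -/
def IsNormal (α : Fin 3) : Prop := ∀ X Y, NOne F V α X Y = 0

/-- A 2-form is closed. -/
def IsClosedTwo (ω : V → V → F) : Prop := ∀ X Y Z, dTwo F V ω X Y Z = 0

/-- The structure `(φ_α, ξ_α, η_α, g)` is quasi-Sasakian: normal with closed
fundamental 2-form. -/
def IsQuasiSasakian (α : Fin 3) : Prop :=
  IsNormal F V α ∧ IsClosedTwo F V (Phi F V α)

/-- `M` is 3-cosymplectic: each structure is normal with `dη_α = 0` and `dΦ_α = 0`. -/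
def ThreeCosymplectic : Prop :=
  ∀ α, IsNormal F V α ∧ (∀ X Y, dOne F V (et F V α) X Y = 0) ∧
    IsClosedTwo F V (Phi F V α)

/-- `M` is 3-α-Sasakian with constant `a ≠ 0`: each structure is normal (an
`α`-Sasakian structure) and `dη_δ = a Φ_δ`. -/
def Is3AlphaSasakianWith (a : ℝ) : Prop :=
  a ≠ 0 ∧ (∀ δ, IsNormal F V δ) ∧
    ∀ (δ : Fin 3) (X Y : V), dOne F V (et F V δ) X Y = algebraMap ℝ F a * Phi F V δ X Y

/-- A vector field is horizontal: it lies in `H = ∩_α ker η_α`. -/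
def Horiz (X : V) : Prop := ∀ α, et F V α X = 0

/-- A vector field is vertical: it lies in `V = ⟨ξ₁, ξ₂, ξ₃⟩`. -/
def InVert (X : V) : Prop :=
  ∃ p q r : F, X = p • rxi F V 0 + q • rxi F V 1 + r • rxi F V 2

/-- The distribution `E^{4m} = {X ∈ H : i_X dη_α = 0}`. -/
def InE4m (X : V) : Prop :=
  Horiz F V X ∧ ∀ (α : Fin 3) (Y : V), dOne F V (et F V α) X Y = 0

/-- The distribution `E^{4l}`: the orthogonal complement of `E^{4m}` in `H`. -/
def InE4l (X : V) : Prop :=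
  Horiz F V X ∧ ∀ Y, InE4m F V Y → gm F V X Y = 0

/-- The distribution `E^{4l+3} = E^{4l} ⊕ V`. -/
def InE4l3 (X : V) : Prop :=
  ∃ Y Z, InE4l F V Y ∧ InVert F V Z ∧ X = Y + Z

/-- The distribution `E^{4m+3} = E^{4m} ⊕ V`. -/
def InE4m3 (X : V) : Prop :=
  ∃ Y Z, InE4m F V Y ∧ InVert F V Z ∧ X = Y + Z

/-- The horizontal component `X_H = X - ∑_α η_α(X) ξ_α` of a vector field. -/
def horComp (X : V) : V := X - ∑ α : Fin 3, et F V α X • rxi F V α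

/-- A vector field is basic with respect to the foliation defined by `E^{4m}`. -/
def BasicE4m (X : V) : Prop :=
  InE4l3 F V X ∧ ∀ W, InE4m F V W → InE4m F V (lie F V W X)

/-- A vector field is basic with respect to the foliation defined by `E^{4l+3}`. -/
def BasicE4l3 (X : V) : Prop :=
  InE4m F V X ∧ ∀ W, InE4l3 F V W → InE4l3 F V (lie F V W X)

end acm

/-- A 3-quasi-Sasakian structure: each of the three almost contact metric
structures is quasi-Sasakian.  We also record, as part of the structure, the
standard structural facts established for such manifolds in the literature
(Cappelletti Montano–De Nicola–Dileo): the Reeb commutation relations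
`[ξ_α, ξ_β] = c ξ_γ`, the splitting `H = E^{4l} ⊕ E^{4m}` (constancy of the
rank), the `φ_α`-invariance of both distributions, and the tensors `ψ_α`
(equal to `φ_α` on `E^{4l+3}` and vanishing on `E^{4m}` when the rank is
`4l+3`, i.e. `c ≠ 0`; equal to `φ_α` on `E^{4l}` and vanishing on `E^{4m+3}`
when the rank is `4l+1`, i.e. `c = 0`). -/
class ThreeQS (F V : Type) [CommRing F] [Algebra ℝ F] [AddCommGroup V] [Module F V]
    [SmoothSetting F V] [ACM3 F V] where
  qs : ∀ α, IsQuasiSasakian F V α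
  c : ℝ
  reeb_bracket : ∀ a b c', Cyclic a b c' →
    lie F V (rxi F V a) (rxi F V b) = algebraMap ℝ F c • rxi F V c'
  horiz_split : ∀ X, Horiz F V X → ∃ Y Z, InE4l F V Y ∧ InE4m F V Z ∧ X = Y + Z
  phi_E4l : ∀ α X, InE4l F V X → InE4l F V (ph F V α X)
  phi_E4m : ∀ α X, InE4m F V X → InE4m F V (ph F V α X)
  psi : Fin 3 → V → V
  psi_add : ∀ α (X Y : V), psi α (X + Y) = psi α X + psi α Y
  psi_smul : ∀ α (f : F) (X : V), psi α (f • X) = f • psi α X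
  psi_E4l : ∀ α X, InE4l F V X → psi α X = ph F V α X
  psi_E4m : ∀ α X, InE4m F V X → psi α X = 0
  psi_vert_of_ne : c ≠ 0 → ∀ α β, psi α (rxi F V β) = ph F V α (rxi F V β)
  psi_vert_of_eq : c = 0 → ∀ α β, psi α (rxi F V β) = 0

section tqs

variable (F V : Type) [CommRing F] [Algebra ℝ F] [AddCommGroup V] [Module F V]
  [SmoothSetting F V] [ACM3 F V] [ThreeQS F V]

/-- The constant `c` with `[ξ_α, ξ_β] = c ξ_γ`. -/
def cc : ℝ := ThreeQS.c F V

/-- The tensors `ψ_α`. -/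
def psiT (α : Fin 3) (X : V) : V := ThreeQS.psi F α X

/-- The tensors `θ_α = φ_α - ψ_α`. -/
def thetaT (α : Fin 3) (X : V) : V := ph F V α X - psiT F V α X

/-- The 2-forms `Θ_α(X,Y) = g(X, θ_α Y)`. -/
def ThetaForm (α : Fin 3) (X Y : V) : F := gm F V X (thetaT F V α Y)

end tqs

/-- The 3-quasi-Sasakian manifold has rank `4l+3`: the constant `c` is nonzero
and the orthonormal frame is adapted to the splitting
`TM = E^{4l} ⊕ E^{4m} ⊕ ⟨ξ₁,ξ₂,ξ₃⟩` with `dim E^{4l} = 4l` (hence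
`dim E^{4m} = 4m`, `m = n - l`, and the rank of the `η_α` is `4l+3`). -/
class HasRank (F V : Type) [CommRing F] [Algebra ℝ F] [AddCommGroup V] [Module F V]
    [SmoothSetting F V] [ACM3 F V] [ThreeQS F V] (l : ℕ) : Prop where
  c_ne : cc F V ≠ 0
  l_le : l ≤ dimn F V
  frame_E4l : ∀ i : Fin (4 * dimn F V + 3), i.val < 4 * l → InE4l F V (fr F V i)
  frame_E4m : ∀ i : Fin (4 * dimn F V + 3), 4 * l ≤ i.val → i.val < 4 * dimn F V →
    InE4m F V (fr F V i)
  frame_xi : ∀ (i : Fin (4 * dimn F V + 3)) (a : Fin 3),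
    i.val = 4 * dimn F V + a.val → fr F V i = rxi F V a

/-- The Levi-Civita connection of `g`: the unique torsion-free metric connection. -/
class LeviCivita (F V : Type) [CommRing F] [Algebra ℝ F] [AddCommGroup V] [Module F V]
    [SmoothSetting F V] [ACM3 F V] where
  nabla : V → V → V
  nabla_addLeft : ∀ X Y Z : V, nabla (X + Y) Z = nabla X Z + nabla Y Z
  nabla_smulLeft : ∀ (f : F) (X Y : V), nabla (f • X) Y = f • nabla X Y
  nabla_addRight : ∀ X Y Z : V, nabla X (Y + Z) = nabla X Y + nabla X Z
  nabla_leibniz : ∀ (X : V) (f : F) (Y : V),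
    nabla X (f • Y) = der F V X f • Y + f • nabla X Y
  nabla_metric : ∀ X Y Z : V,
    der F V X (gm F V Y Z) = gm F V (nabla X Y) Z + gm F V Y (nabla X Z)
  nabla_torsionFree : ∀ X Y : V, nabla X Y - nabla Y X = lie F V X Y

section curv

variable (F V : Type) [CommRing F] [Algebra ℝ F] [AddCommGroup V] [Module F V]
  [SmoothSetting F V] [ACM3 F V] [LeviCivita F V]

/-- The Levi-Civita covariant derivative `∇_X Y`. -/
def nab (X Y : V) : V := LeviCivita.nabla F X Y

/-- The Riemannian curvature `R(X,Y)Z = ∇_X ∇_Y Z - ∇_Y ∇_X Z - ∇_{[X,Y]} Z`. -/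
def Rcurv (X Y Z : V) : V :=
  nab F V X (nab F V Y Z) - nab F V Y (nab F V X Z) - nab F V (lie F V X Y) Z

/-- The Ricci tensor `Ric(X,Y) = ∑_i g(R(e_i, X)Y, e_i)`. -/
def Ric (X Y : V) : F :=
  ∑ i, gm F V (Rcurv F V (fr F V i) X Y) (fr F V i)

/-- The scalar curvature. -/
def Scal : F := ∑ i, Ric F V (fr F V i) (fr F V i)

/-- `M` is Einstein: `Ric = a g` for a constant `a`. -/
def Einstein : Prop :=
  ∃ a : ℝ, ∀ X Y, Ric F V X Y = algebraMap ℝ F a * gm F V X Y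

/-- `M` is η-Einstein: `Ric = a g + b ∑_α η_α ⊗ η_α` for constants `a, b`. -/
def EtaEinstein : Prop :=
  ∃ a b : ℝ, ∀ X Y, Ric F V X Y
    = algebraMap ℝ F a * gm F V X Y
      + algebraMap ℝ F b * ∑ α : Fin 3, et F V α X * et F V α Y

end curv

/-- A (Koszul) linear connection on vector fields. -/
def IsConnection (F V : Type) [CommRing F] [Algebra ℝ F] [AddCommGroup V] [Module F V]
    [SmoothSetting F V] (D : V → V → V) : Prop :=
  (∀ X Y Z : V, D (X + Y) Z = D X Z + D Y Z) ∧
  (∀ (f : F) (X Y : V), D (f • X) Y = f • D X Y) ∧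
  (∀ X Y Z : V, D X (Y + Z) = D X Y + D X Z) ∧
  (∀ (X : V) (f : F) (Y : V), D X (f • Y) = der F V X f • Y + f • D X Y)

end QS3

namespace QS3

section almostSasakian

variable {F V : Type} [CommRing F] [Algebra ℝ F] [AddCommGroup V] [Module F V]
  [SmoothSetting F V]

lemma der_add (X : V) (f₁ f₂ : F) : der F V X (f₁ + f₂) = der F V X f₁ + der F V X f₂ :=
  SmoothSetting.act_add X f₁ f₂

lemma der_mul (X : V) (f₁ f₂ : F) :
    der F V X (f₁ * f₂) = der F V X f₁ * f₂ + f₁ * der F V X f₂ :=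
  SmoothSetting.act_mul X f₁ f₂

lemma der_algebraMap (X : V) (r : ℝ) : der F V X (algebraMap ℝ F r) = 0 :=
  SmoothSetting.act_const X r

lemma der_zero (X : V) : der F V X (0 : F) = 0 := by
  simpa using der_algebraMap (F := F) X 0

lemma der_neg (X : V) (f : F) : der F V X (-f) = -der F V X f := by
  have h := der_add X f (-f)
  rw [add_neg_cancel, der_zero] at h
  linear_combination -h

lemma der_sub (X : V) (f₁ f₂ : F) : der F V X (f₁ - f₂) = der F V X f₁ - der F V X f₂ := by
  rw [sub_eq_add_neg, der_add, der_neg, ← sub_eq_add_neg]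

lemma der_lie (X Y : V) (f : F) :
    der F V (lie F V X Y) f = der F V X (der F V Y f) - der F V Y (der F V X f) :=
  SmoothSetting.bracket_act X Y f

lemma lie_antisymm (X Y : V) : lie F V X Y = -lie F V Y X :=
  SmoothSetting.bracket_antisymm X Y

lemma lie_jacobi (X Y Z : V) :
    lie F V X (lie F V Y Z) + lie F V Y (lie F V Z X) + lie F V Z (lie F V X Y) = 0 :=
  SmoothSetting.jacobi X Y Z

lemma two_smul_dOne (θ : V → F) (X Y : V) :
    (2 : ℝ) • dOne F V θ X Y
      = der F V X (θ Y) - der F V Y (θ X) - θ (lie F V X Y) := by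
  rw [dOne, smul_smul, mul_inv_cancel₀ two_ne_zero, one_smul]

variable [ACM3 F V]

lemma gm_comm (X Y : V) : gm F V X Y = gm F V Y X := ACM3.g_symm X Y

lemma gm_add_left (X Y Z : V) : gm F V (X + Y) Z = gm F V X Z + gm F V Y Z :=
  ACM3.g_addLeft X Y Z

lemma gm_smul_left (f : F) (X Y : V) : gm F V (f • X) Y = f * gm F V X Y :=
  ACM3.g_smulLeft f X Y

lemma gm_neg_left (X Y : V) : gm F V (-X) Y = -gm F V X Y := by
  simpa using gm_smul_left (-1 : F) X Y

lemma gm_sub_left (X Y Z : V) : gm F V (X - Y) Z = gm F V X Z - gm F V Y Z := by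
  rw [sub_eq_add_neg, gm_add_left, gm_neg_left, ← sub_eq_add_neg]

lemma gm_zero_left (X : V) : gm F V 0 X = 0 := by
  simpa using gm_smul_left (0 : F) 0 X

lemma gm_add_right (X Y Z : V) : gm F V X (Y + Z) = gm F V X Y + gm F V X Z := by
  rw [gm_comm, gm_add_left, gm_comm Y, gm_comm Z]

lemma gm_smul_right (f : F) (X Y : V) : gm F V X (f • Y) = f * gm F V X Y := by
  rw [gm_comm, gm_smul_left, gm_comm Y]

lemma gm_neg_right (X Y : V) : gm F V X (-Y) = -gm F V X Y := by
  rw [gm_comm, gm_neg_left, gm_comm Y]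

lemma et_eq_gm (δ : Fin 3) (X : V) : et F V δ X = gm F V X (rxi F V δ) := ACM3.eta_eq δ X

lemma et_add (δ : Fin 3) (X Y : V) : et F V δ (X + Y) = et F V δ X + et F V δ Y := by
  simp only [et_eq_gm, gm_add_left]

lemma et_sub (δ : Fin 3) (X Y : V) : et F V δ (X - Y) = et F V δ X - et F V δ Y := by
  simp only [et_eq_gm, gm_sub_left]

lemma et_smul (δ : Fin 3) (f : F) (X : V) : et F V δ (f • X) = f * et F V δ X := by
  simp only [et_eq_gm, gm_smul_left]

lemma et_neg (δ : Fin 3) (X : V) : et F V δ (-X) = -et F V δ X := by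
  simp only [et_eq_gm, gm_neg_left]

lemma et_zero (δ : Fin 3) : et F V δ 0 = 0 := by
  simp only [et_eq_gm, gm_zero_left]

lemma et_rxi_self (δ : Fin 3) : et F V δ (rxi F V δ) = 1 := ACM3.eta_xi δ

lemma ph_add (δ : Fin 3) (X Y : V) : ph F V δ (X + Y) = ph F V δ X + ph F V δ Y :=
  ACM3.phi_add δ X Y

lemma ph_smul (δ : Fin 3) (f : F) (X : V) : ph F V δ (f • X) = f • ph F V δ X :=
  ACM3.phi_smul δ f X

lemma ph_neg (δ : Fin 3) (X : V) : ph F V δ (-X) = -ph F V δ X := by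
  simpa using ph_smul δ (-1 : F) X

lemma ph_zero (δ : Fin 3) : ph F V δ 0 = 0 := by
  simpa using ph_smul δ (0 : F) (0 : V)

lemma ph_ph (δ : Fin 3) (X : V) :
    ph F V δ (ph F V δ X) = -X + et F V δ X • rxi F V δ := ACM3.acm_sq δ X

lemma gm_ph_ph (δ : Fin 3) (X Y : V) :
    gm F V (ph F V δ X) (ph F V δ Y) = gm F V X Y - et F V δ X * et F V δ Y :=
  ACM3.compat δ X Y

lemma Cyclic.rotate {a b c : Fin 3} (h : Cyclic a b c) : Cyclic b c a := by
  simp only [Cyclic, Prod.mk.injEq] at h ⊢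
  tauto

lemma ph_comp {a b c : Fin 3} (h : Cyclic a b c) (X : V) :
    ph F V a (ph F V b X) = ph F V c X + et F V b X • rxi F V a :=
  (sub_eq_iff_eq_add.mp (ACM3.quat_phi a b c h X).symm)

lemma ph_comp_swap {a b c : Fin 3} (h : Cyclic a b c) (X : V) :
    ph F V b (ph F V a X) = -ph F V c X + et F V a X • rxi F V b := by
  have h' : ph F V c X = -ph F V b (ph F V a X) + et F V a X • rxi F V b :=
    ACM3.quat_phi' a b c h X
  rw [h']
  abel

lemma ph_rxi_next {a b c : Fin 3} (h : Cyclic a b c) :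
    ph F V a (rxi F V b) = rxi F V c := (ACM3.quat_xi a b c h).symm

lemma et_ph_next {a b c : Fin 3} (h : Cyclic a b c) (X : V) :
    et F V a (ph F V b X) = et F V c X := (ACM3.quat_eta a b c h X).symm

lemma et_ph_prev {a b c : Fin 3} (h : Cyclic a b c) (X : V) :
    et F V b (ph F V a X) = -et F V c X := by
  have h' : et F V c X = -et F V b (ph F V a X) := ACM3.quat_eta' a b c h X
  rw [h', neg_neg]

lemma et_rxi_comm (a b : Fin 3) : et F V a (rxi F V b) = et F V b (rxi F V a) := by
  rw [et_eq_gm, gm_comm, ← et_eq_gm]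

lemma et_rxi_next {a b c : Fin 3} (h : Cyclic a b c) : et F V b (rxi F V c) = 0 := by
  have h₁ := et_ph_prev (F := F) h (rxi F V b)
  rw [ph_rxi_next h, et_rxi_comm c b] at h₁
  have h₂ : (2 : ℝ) • et F V b (rxi F V c) = 0 := by
    rw [two_smul]
    linear_combination h₁
  exact (smul_eq_zero_iff_right (two_ne_zero : (2 : ℝ) ≠ 0)).mp h₂

lemma ph_rxi_self {a b c : Fin 3} (h : Cyclic a b c) : ph F V a (rxi F V a) = 0 := by
  have rot : ∀ {a b c : Fin 3}, Cyclic a b c →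
      ph F V a (rxi F V a) = ph F V c (rxi F V c) := by
    intro a b c h
    have h₁ := ph_comp (F := F) h (rxi F V c)
    rwa [ph_rxi_next h.rotate, et_rxi_next h, zero_smul, add_zero] at h₁
  have prop : ∀ δ : Fin 3,
      ph F V δ (rxi F V δ) = et F V δ (ph F V δ (rxi F V δ)) • rxi F V δ := by
    intro δ
    have h₀ : ph F V δ (ph F V δ (rxi F V δ)) = 0 := by
      rw [ph_ph, et_rxi_self, one_smul, neg_add_cancel]
    have h₁ := ph_ph (F := F) δ (ph F V δ (rxi F V δ))
    rw [h₀, ph_zero, eq_comm, neg_add_eq_zero] at h₁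
    exact h₁
  have hb : et F V b (ph F V b (rxi F V b)) = 0 := by
    rw [rot h.rotate, prop a, et_smul, et_rxi_comm b a, et_rxi_next h.rotate.rotate, mul_zero]
  rw [← rot h.rotate, prop b, hb, zero_smul]

lemma et_ph_self {a b c : Fin 3} (h : Cyclic a b c) (X : V) : et F V a (ph F V a X) = 0 := by
  have h₁ := ph_ph (F := F) a (ph F V a X)
  rw [ph_ph a X, ph_add, ph_neg, ph_smul, ph_rxi_self h, smul_zero, add_zero,
    left_eq_add] at h₁
  simpa [et_smul, et_zero, et_rxi_self] using congrArg (et F V a) h₁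

lemma Phi_swap {a b c : Fin 3} (h : Cyclic a b c) (X Y : V) :
    Phi F V a X Y = -Phi F V a Y X := by
  have h₁ := gm_ph_ph (F := F) a X (ph F V a Y)
  rw [et_ph_self h, ph_ph, gm_add_right, gm_neg_right, gm_smul_right, ← et_eq_gm,
    et_ph_self h] at h₁
  simp only [Phi, gm_comm Y]
  linear_combination -h₁

lemma gm_ph_left {a b c : Fin 3} (h : Cyclic a b c) (X Y : V) :
    gm F V (ph F V a X) Y = -gm F V X (ph F V a Y) := by
  rw [gm_comm]
  exact Phi_swap h Y X

lemma Phi_next_ph_right {a b c : Fin 3} (h : Cyclic a b c) (X Y : V) :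
    Phi F V b X (ph F V a Y) = -Phi F V c X Y + et F V a Y * et F V b X := by
  rw [Phi, ph_comp_swap h, gm_add_right, gm_neg_right, gm_smul_right, ← et_eq_gm, Phi]

lemma Phi_next_ph_left {a b c : Fin 3} (h : Cyclic a b c) (X Y : V) :
    Phi F V b (ph F V a X) Y = -Phi F V c X Y - et F V a X * et F V b Y := by
  rw [Phi, gm_ph_left h, ph_comp h, gm_add_right, gm_smul_right, ← et_eq_gm, Phi]
  ring

lemma Phi_prev_ph_right {a b c : Fin 3} (h : Cyclic a b c) (X Y : V) :
    Phi F V c X (ph F V a Y) = Phi F V b X Y + et F V a Y * et F V c X := by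
  rw [Phi, ph_comp h.rotate.rotate, gm_add_right, gm_smul_right, ← et_eq_gm, Phi]

lemma Phi_prev_ph_left {a b c : Fin 3} (h : Cyclic a b c) (X Y : V) :
    Phi F V c (ph F V a X) Y = Phi F V b X Y - et F V a X * et F V c Y := by
  rw [Phi, gm_ph_left h, ph_comp_swap h.rotate.rotate, gm_add_right, gm_smul_right,
    gm_neg_right, ← et_eq_gm, Phi]
  ring

lemma Phi_self_ph_right (a : Fin 3) (X Y : V) :
    Phi F V a X (ph F V a Y) = -gm F V X Y + et F V a X * et F V a Y := by
  rw [Phi, ph_ph, gm_add_right, gm_smul_right, gm_neg_right, ← et_eq_gm]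
  ring

lemma Phi_add_left (δ : Fin 3) (X Y Z : V) :
    Phi F V δ (X + Y) Z = Phi F V δ X Z + Phi F V δ Y Z :=
  gm_add_left X Y _

lemma Phi_sub_left (δ : Fin 3) (X Y Z : V) :
    Phi F V δ (X - Y) Z = Phi F V δ X Z - Phi F V δ Y Z :=
  gm_sub_left X Y _

lemma Phi_neg_left (δ : Fin 3) (X Y : V) : Phi F V δ (-X) Y = -Phi F V δ X Y :=
  gm_neg_left X _

lemma Phi_smul_left (δ : Fin 3) (f : F) (X Y : V) :
    Phi F V δ (f • X) Y = f * Phi F V δ X Y :=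
  gm_smul_left f X _

lemma et_lie {k : ℝ} {δ : Fin 3}
    (h : ∀ X Y : V, dOne F V (et F V δ) X Y = algebraMap ℝ F k * Phi F V δ X Y) (X Y : V) :
    et F V δ (lie F V X Y)
      = der F V X (et F V δ Y) - der F V Y (et F V δ X)
        - 2 * (algebraMap ℝ F k * Phi F V δ X Y) := by
  have h₁ := two_smul_dOne (F := F) (et F V δ) X Y
  rw [h, two_smul] at h₁
  linear_combination h₁

/-- If `dη = k Φ` with `k ≠ 0`, then `Φ` is closed, in expanded form. -/
lemma Phi_closed {k : ℝ} (hk : k ≠ 0) {δ : Fin 3}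
    (h : ∀ X Y : V, dOne F V (et F V δ) X Y = algebraMap ℝ F k * Phi F V δ X Y)
    (X Y Z : V) :
    der F V X (Phi F V δ Y Z) + der F V Y (Phi F V δ Z X) + der F V Z (Phi F V δ X Y)
      - Phi F V δ (lie F V X Y) Z - Phi F V δ (lie F V Y Z) X
      - Phi F V δ (lie F V Z X) Y = 0 := by
  have hder : ∀ W X Y : V, 2 * (algebraMap ℝ F k * der F V W (Phi F V δ X Y))
      = der F V W (der F V X (et F V δ Y)) - der F V W (der F V Y (et F V δ X))
        - der F V W (et F V δ (lie F V X Y)) := by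
    intro W X Y
    have h₁ := congrArg (der F V W) (et_lie h X Y)
    simp only [two_mul, der_sub, der_add, der_mul, der_algebraMap] at h₁
    linear_combination h₁
  have hjac : et F V δ (lie F V X (lie F V Y Z)) + et F V δ (lie F V Y (lie F V Z X))
      + et F V δ (lie F V Z (lie F V X Y)) = 0 := by
    rw [← et_add, ← et_add, lie_jacobi, et_zero]
  have hswap : ∀ X Y : V, et F V δ (lie F V X Y) = -et F V δ (lie F V Y X) := by
    intro X Y
    rw [lie_antisymm, et_neg]
  rw [hswap X, hswap Y, hswap Z] at hjac
  have e₁ := et_lie h (lie F V X Y) Z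
  have e₂ := et_lie h (lie F V Y Z) X
  have e₃ := et_lie h (lie F V Z X) Y
  rw [der_lie] at e₁ e₂ e₃
  have hu : IsUnit (algebraMap ℝ F (2 * k)) :=
    (IsUnit.mk0 (2 * k) (mul_ne_zero two_ne_zero hk)).map _
  refine hu.mul_right_eq_zero.mp ?_
  rw [map_mul, map_ofNat]
  linear_combination hder X Y Z + hder Y Z X + hder Z X Y - hjac - e₁ - e₂ - e₃

lemma NOne_eq (a : Fin 3) (X Y : V) :
    NOne F V a X Y = -lie F V X Y + lie F V (ph F V a X) (ph F V a Y)
      - ph F V a (lie F V (ph F V a X) Y) - ph F V a (lie F V X (ph F V a Y))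
      + (der F V X (et F V a Y) - der F V Y (et F V a X)) • rxi F V a := by
  rw [NOne, Nij, ph_ph, two_smul_dOne, sub_smul _ (et F V a (lie F V X Y))]
  abel

lemma et_NOne {k : ℝ} (h : ∀ (δ : Fin 3) (X Y : V),
      dOne F V (et F V δ) X Y = algebraMap ℝ F k * Phi F V δ X Y)
    {a b c : Fin 3} (hc : Cyclic a b c) (X Y : V) : et F V b (NOne F V a X Y) = 0 := by
  have hz : et F V b (rxi F V a) = 0 := by rw [et_rxi_comm, et_rxi_next hc.rotate.rotate]
  simp only [NOne_eq, et_add, et_sub, et_neg, et_smul, hz, et_ph_prev hc, et_lie (h _),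
    et_ph_next hc.rotate.rotate, Phi_next_ph_right hc,
    Phi_prev_ph_right hc, Phi_prev_ph_left hc, der_neg]
  ring

lemma Phi_NOne {k : ℝ} (hk : k ≠ 0) (h : ∀ (δ : Fin 3) (X Y : V),
      dOne F V (et F V δ) X Y = algebraMap ℝ F k * Phi F V δ X Y)
    {a b c : Fin 3} (hc : Cyclic a b c) (X Y Z : V) (hZ : et F V b Z = 0) :
    Phi F V b (NOne F V a X Y) Z = 0 := by
  have hr : Phi F V b (rxi F V a) Z = et F V c Z := by
    rw [Phi, gm_comm, ← et_eq_gm, et_ph_next hc]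
  have A₁ := Phi_closed hk (h b) (ph F V a X) (ph F V a Y) Z
  have A₂ := Phi_closed hk (h b) X Y Z
  have A₃ := Phi_closed hk (h c) (ph F V a X) Y Z
  have A₄ := Phi_closed hk (h c) X (ph F V a Y) Z
  have hbZX := Phi_swap (F := F) hc.rotate Z X
  have hcZX := Phi_swap (F := F) hc.rotate.rotate Z X
  simp only [NOne_eq, Phi_add_left, Phi_sub_left, Phi_neg_left, Phi_smul_left, hr, hZ, hbZX,
    hcZX, et_ph_prev hc, et_ph_self hc, et_lie (h _), Phi_next_ph_right hc, Phi_next_ph_left hc,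
    Phi_prev_ph_right hc, Phi_prev_ph_left hc, der_neg, der_add, der_sub, der_mul, der_zero]
    at A₁ A₂ A₃ A₄ ⊢
  linear_combination -A₁ + A₂ - A₃ - A₄

lemma isNormal_of_cyclic {k : ℝ} (hk : k ≠ 0) (h : ∀ (δ : Fin 3) (X Y : V),
      dOne F V (et F V δ) X Y = algebraMap ℝ F k * Phi F V δ X Y)
    {a b c : Fin 3} (hc : Cyclic a b c) : IsNormal F V a := by
  intro X Y
  refine ACM3.g_nondeg (F := F) _ fun Z => ?_
  have h₁ := Phi_NOne hk h hc X Y (ph F V b Z) (et_ph_self hc.rotate Z)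
  rw [Phi_self_ph_right, et_NOne h hc, zero_mul, add_zero, neg_eq_zero] at h₁
  exact h₁

end almostSasakian

/-- Every almost 3-α-Sasakian manifold is necessarily
3-α-Sasakian: if an almost 3-contact metric manifold satisfies
`dη_δ = a Φ_δ` for each `δ` and some `a ≠ 0`, then each of the three almost
contact metric structures is automatically normal. -/
theorem almost3AlphaSasakian_isNormal (F V : Type) [CommRing F] [Algebra ℝ F] [AddCommGroup V] [Module F V]
    [SmoothSetting F V] [ACM3 F V] (a : ℝ) (ha : a ≠ 0)
    (h : ∀ (δ : Fin 3) (X Y : V),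
      dOne F V (et F V δ) X Y = algebraMap ℝ F a * Phi F V δ X Y) :
    ∀ δ : Fin 3, IsNormal F V δ := by
  intro δ
  fin_cases δ
  · exact isNormal_of_cyclic ha h (b := 1) (c := 2) (by simp [Cyclic])
  · exact isNormal_of_cyclic ha h (b := 2) (c := 0) (by simp [Cyclic])
  · exact isNormal_of_cyclic ha h (b := 0) (c := 1) (by simp [Cyclic])

end QS3
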